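/- Let g be a symmetric bilinear form on V and v ∈ V a vector with g(v,v) > 0. Define the angular form h(u,w) := g(u,w) − g(v,u)·g(v,w)/g(v,v). Then g is nondegenerate with index n−1 if and only if h is negative semi-definite (h(u,u) ≤ 0 for all u ∈ V) and its radical {u ∈ V : h(u,w) = 0 for all w ∈ V} equals the line spanned by v. -/

import Mathlib

open Set Module

noncomputable section

variable {V : Type*} [AddCommGroup V] [Module ℝ V]

/-- Lorentzian: nondegenerate and negative definite on a subspace of dimension `n-1`. -/
def IsLorentzForm (g : V → V → ℝ) : Prop :=
  (∀ u : V, (∀ w : V, g u w = 0) → u = 0) ∧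
  ∃ W : Submodule ℝ V, finrank ℝ W = finrank ℝ V - 1 ∧
    ∀ u ∈ W, u ≠ 0 → g u u < 0

/-- A vector outside a subspace of codimension at most one spans, with it, the whole space. -/
lemma exists_add_smul_of_notMem [FiniteDimensional ℝ V] {W : Submodule ℝ V}
    (hW : finrank ℝ V ≤ finrank ℝ W + 1) {v : V} (hv : v ∉ W) (u : V) :
    ∃ w ∈ W, ∃ c : ℝ, u = w + c • v := by
  have hv0 : v ≠ 0 := fun h0 => hv (h0 ▸ W.zero_mem)
  have htop : W ⊔ Submodule.span ℝ {v} = ⊤ := by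
    refine Submodule.eq_top_of_disjoint _ _ ?_ ?_
    · rwa [finrank_span_singleton hv0]
    · exact (Submodule.disjoint_span_singleton' hv0).2 hv
  have hu : u ∈ W ⊔ Submodule.span ℝ {v} := htop ▸ Submodule.mem_top
  obtain ⟨w, hw, z, hz, rfl⟩ := Submodule.mem_sup.1 hu
  obtain ⟨c, rfl⟩ := Submodule.mem_span_singleton.1 hz
  exact ⟨w, hw, c, rfl⟩

/-- A symmetric form that is negative definite on a hyperplane and positive at `v` is negative
definite on the orthogonal complement of `v`. -/
lemma apply_self_neg_of_orthogonal [FiniteDimensional ℝ V] {g : V →ₗ[ℝ] V →ₗ[ℝ] ℝ}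
    (hsym : ∀ u w : V, g u w = g w u) {v : V} (hv : 0 < g v v) {W : Submodule ℝ V}
    (hW : finrank ℝ V ≤ finrank ℝ W + 1) (hneg : ∀ u ∈ W, u ≠ 0 → g u u < 0)
    {u : V} (hvu : g v u = 0) (hu : u ≠ 0) : g u u < 0 := by
  have hvW : v ∉ W := fun hmem =>
    lt_asymm hv (hneg v hmem (by rintro rfl; simp at hv))
  obtain ⟨w, hw, c, rfl⟩ := exists_add_smul_of_notMem hW hvW u
  have hwv := hsym w v
  simp only [map_add, map_smul, LinearMap.add_apply, LinearMap.smul_apply, smul_eq_mul]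
    at hvu ⊢
  have hself : g w w + c * g v w + (c * g w v + c * (c * g v v))
      = g w w - c ^ 2 * g v v := by
    rw [hwv]; linear_combination 2 * c * hvu
  have hc := mul_nonneg (sq_nonneg c) hv.le
  by_cases hw0 : w = 0
  · subst hw0
    have hc0 : c ≠ 0 := by rintro rfl; simp at hu
    have := mul_pos (pow_pos (abs_pos.2 hc0) 2) hv
    rw [sq_abs] at this
    simp only [map_zero, LinearMap.zero_apply] at hself ⊢
    linarith
  · have := hneg w hw hw0
    linarith

/-- An isotropic vector of a negative semi-definite symmetric form lies in its radical. -/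
lemma apply_eq_zero_of_nonpos {h : V →ₗ[ℝ] V →ₗ[ℝ] ℝ} (hsym : ∀ u w : V, h u w = h w u)
    (hnonpos : ∀ u : V, h u u ≤ 0) {u : V} (hu : h u u = 0) (w : V) : h u w = 0 := by
  by_contra hne
  have key := hnonpos (w + ((1 - h w w) / (2 * h u w)) • u)
  simp only [map_add, map_smul, LinearMap.add_apply, LinearMap.smul_apply, smul_eq_mul, hu,
    hsym w u] at key
  have ht : (1 - h w w) / (2 * h u w) * h u w = (1 - h w w) / 2 := by field_simp
  linarith

/-- a symmetric bilinear form with `g(v,v) > 0` is Lorentzian iff its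
angular form is negative semi-definite with radical exactly the line spanned by `v`. -/
theorem stmt_10 [FiniteDimensional ℝ V] (hn : 2 ≤ finrank ℝ V)
    (g : V →ₗ[ℝ] V →ₗ[ℝ] ℝ) (hsym : ∀ u w : V, g u w = g w u)
    (v : V) (hv : 0 < g v v)
    (h : V → V → ℝ) (hdef : ∀ u w : V, h u w = g u w - g v u * g v w / g v v) :
    IsLorentzForm (fun u w => g u w) ↔
      ((∀ u : V, h u u ≤ 0) ∧
        {u : V | ∀ w : V, h u w = 0} = (Submodule.span ℝ {v} : Submodule ℝ V)) := by
  have hv0 : g v v ≠ 0 := hv.ne'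
  constructor
  · rintro ⟨-, W, hW, hneg⟩
    have horth (u : V) : g v (u - (g v u / g v v) • v) = 0 := by
      simp [hv0]
    have hproj (u : V) :
        h u u = g (u - (g v u / g v v) • v) (u - (g v u / g v v) • v) := by
      simp only [hdef, map_sub, map_smul, LinearMap.sub_apply, LinearMap.smul_apply,
        smul_eq_mul, hsym u v]
      field_simp
      ring
    have hlt {u : V} (hvu : g v u = 0) (hu : u ≠ 0) : g u u < 0 :=
      apply_self_neg_of_orthogonal hsym hv (by omega) hneg hvu hu
    refine ⟨fun u => ?_, Set.ext fun u => ⟨fun hu => ?_, fun hu => ?_⟩⟩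
    · rw [hproj]
      by_cases hp : u - (g v u / g v v) • v = 0
      · simp [hp]
      · exact (hlt (horth u) hp).le
    · have hp : u - (g v u / g v v) • v = 0 := by
        by_contra hp
        exact (hlt (horth u) hp).ne (hproj u ▸ hu u)
      exact Submodule.mem_span_singleton.2 ⟨_, (sub_eq_zero.1 hp).symm⟩
    · obtain ⟨c, rfl⟩ := Submodule.mem_span_singleton.1 hu
      intro w
      simp only [hdef, map_smul, LinearMap.smul_apply, smul_eq_mul]
      field_simp
      ring
  · rintro ⟨hnonpos, hrad⟩
    have hzero {u : V} (hvu : g v u = 0) (hu : ∀ w, h u w = 0) : u = 0 := by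
      have hmem : u ∈ (Submodule.span ℝ {v} : Set V) := hrad ▸ hu
      obtain ⟨c, rfl⟩ := Submodule.mem_span_singleton.1 hmem
      have hc : c = 0 := by simpa [hv0] using hvu
      simp [hc]
    refine ⟨fun u hu => ?_, LinearMap.ker (g v), ?_, fun u hu hu0 => ?_⟩
    · have hvu : g v u = 0 := (hsym v u).trans (hu v)
      exact hzero hvu fun w => by simpa [hdef, hvu] using hu w
    · have hrank := (g v).finrank_range_add_finrank_ker
      have hsurj : LinearMap.range (g v) = ⊤ :=
        LinearMap.range_eq_top.2 (LinearMap.surjective fun h0 => by simp [h0] at hv)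
      rw [hsurj, finrank_top, finrank_self] at hrank
      omega
    · have hvu : g v u = 0 := hu
      let H : V →ₗ[ℝ] V →ₗ[ℝ] ℝ := g - (g v v)⁻¹ • (g v).smulRight (g v)
      have hH (u w : V) : H u w = h u w := by
        simp only [H, hdef, LinearMap.sub_apply, LinearMap.smul_apply,
          LinearMap.smulRight_apply, smul_eq_mul]
        ring
      have huu : h u u = g u u := by simp [hdef, hvu]
      refine lt_of_le_of_ne (huu.symm.trans_le (hnonpos u)) fun h0 => hu0 (hzero hvu fun w => ?_)
      rw [← hH]
      refine apply_eq_zero_of_nonpos (fun x y => ?_) (fun x => hH x x ▸ hnonpos x) ?_ w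
      · rw [hH, hH, hdef, hdef, hsym x y, mul_comm (g v x)]
      · rw [hH, huu]
        exact h0
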